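/- arXiv:2412.07988 — 2 statements merged into one kernel-verified Lean document; each statement's English description precedes it below -/
import Mathlib

section
/- Duality, first direction (Proposition 'duality'(i), abstract form): let H₀ and H be real Hilbert spaces, D a dense linear subspace of H₀, ∂ : D → H a linear map, and assume D is separable with respect to the graph norm f ↦ (‖f‖_{H₀}² + ‖∂f‖_H²)^{1/2}. Let T > 0, let Ů ∈ D(∂*), let u ∈ L²(0,T;H₀) and c ∈ L¹(0,T;H), and suppose that for every φ ∈ D and every continuously differentiable ψ : ℝ → ℝ vanishing on [T',∞) for some T' < T one has −∫₀^T ψ'(t)⟨u(t), φ⟩_{H₀} dt = ∫₀^T ψ(t)⟨c(t), ∂φ⟩_H dt + ψ(0)⟨∂*Ů, φ⟩_{H₀}. Define U(t) := Ů + ∫₀^t c(s) ds (Bochner integral). Then for almost every t ∈ [0,T] one has U(t) ∈ D(∂*) and ∂* U(t) = u(t). -/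
open RealInnerProductSpace MeasureTheory

set_option synthInstance.maxHeartbeats 1000000
set_option maxHeartbeats 1000000

open scoped ContDiff in
/-- A smooth compactly supported function on `(a, b)` is the derivative of a `C¹` function that
vanishes on a neighbourhood of `[b, ∞)`. -/
lemma exists_contDiff_primitive_eq_zero_near_right {a b : ℝ} (hab : a < b) {η : ℝ → ℝ}
    (hη : ContDiff ℝ ∞ η) (hcomp : HasCompactSupport η) (hsupp : tsupport η ⊆ Set.Ioo a b) :
    ∃ ψ : ℝ → ℝ, ContDiff ℝ 1 ψ ∧ deriv ψ = η ∧ ∃ b' < b, ∀ t, b' ≤ t → ψ t = 0 := by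
  have hderiv : ∀ t, HasDerivAt (fun x => ∫ s in b..x, η s) (η t) t := fun t =>
    hη.continuous.integral_hasStrictDerivAt b t |>.hasDerivAt
  have hderiv_eq : deriv (fun x => ∫ s in b..x, η s) = η := funext fun t => (hderiv t).deriv
  refine ⟨fun x => ∫ s in b..x, η s, ?_, hderiv_eq, ?_⟩
  · rw [contDiff_one_iff_deriv, hderiv_eq]
    exact ⟨fun t => (hderiv t).differentiableAt, hη.continuous⟩
  · obtain ⟨b', hb', hlt⟩ : ∃ b' < b, ∀ t ∈ tsupport η, t < b' := by
      rcases (tsupport η).eq_empty_or_nonempty with h | h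
      · exact ⟨a, hab, by simp [h]⟩
      · obtain ⟨m, hm, hmax⟩ := hcomp.isCompact.exists_isGreatest h
        obtain ⟨b', hmb', hb'b⟩ := exists_between (hsupp hm).2
        exact ⟨b', hb'b, fun t ht => (hmax ht).trans_lt hmb'⟩
    refine ⟨b', hb', fun t ht => ?_⟩
    have hzero : ∀ s ∈ Set.uIcc b t, η s = 0 := fun s hs =>
      image_eq_zero_of_notMem_tsupport fun hs' =>
        (hlt s hs').not_ge ((le_min hb'.le ht).trans hs.1)
    simp [intervalIntegral.integral_congr hzero]

/-- A weak solution on `(0, T)` of the scalar equation `f' = g`, `f 0 = a`, is a.e. equal to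
`a + ∫₀ᵗ g`. -/
lemma ae_eq_add_integral_of_weak_deriv {T : ℝ} (hT : 0 < T) {f g : ℝ → ℝ} {a : ℝ}
    (hf : IntegrableOn f (Set.Ioc 0 T)) (hg : IntegrableOn g (Set.Ioc 0 T))
    (hweak : ∀ ψ : ℝ → ℝ, ContDiff ℝ 1 ψ → (∃ T' < T, ∀ t, T' ≤ t → ψ t = 0) →
      -∫ t in Set.Ioc 0 T, deriv ψ t * f t = (∫ t in Set.Ioc 0 T, ψ t * g t) + ψ 0 * a) :
    ∀ᵐ t ∂(volume.restrict (Set.Ioc 0 T)), a + ∫ s in Set.Ioc 0 t, g s = f t := by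
  set F : ℝ → ℝ := fun t => ∫ s in (0 : ℝ)..t, g s with hF
  have hg' : IntervalIntegrable g volume 0 T :=
    (intervalIntegrable_iff_integrableOn_Ioc_of_le hT.le).2 hg
  have hFac : AbsolutelyContinuousOnInterval F 0 T :=
    hg'.absolutelyContinuousOnInterval_intervalIntegral (by simp)
  have hFint : IntegrableOn F (Set.Ioc 0 T) :=
    (intervalIntegrable_iff_integrableOn_Ioc_of_le hT.le).1 hFac.continuousOn.intervalIntegrable
  have haint : IntegrableOn (fun _ : ℝ => a) (Set.Ioc 0 T) := by simp
  have hdiff : IntegrableOn (fun t => a + F t - f t) (Set.Ioc 0 T) := (haint.add hFint).sub hf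
  have hzero : ∀ᵐ t, t ∈ Set.Ioo 0 T → a + F t - f t = 0 := by
    refine isOpen_Ioo.ae_eq_zero_of_integral_contDiff_smul_eq_zero
      (hdiff.mono_set Set.Ioo_subset_Ioc_self).locallyIntegrableOn fun η hη hcomp hsupp => ?_
    obtain ⟨ψ, hψ, hψη, hψT⟩ := exists_contDiff_primitive_eq_zero_near_right hT hη hcomp hsupp
    have hw := hweak ψ hψ hψT
    have hψT0 : ψ T = 0 := by
      obtain ⟨T', hT', h⟩ := hψT
      exact h T hT'.le
    have hψac : AbsolutelyContinuousOnInterval ψ 0 T :=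
      hψ.contDiffOn.absolutelyContinuousOnInterval
    have hparts := hψac.integral_mul_deriv_eq_deriv_mul hFac
    have hψint : ∫ t in (0 : ℝ)..T, η t = ψ T - ψ 0 := hψη ▸ hψac.integral_deriv_eq_sub
    have hFderiv : ∫ t in (0 : ℝ)..T, ψ t * deriv F t = ∫ t in (0 : ℝ)..T, ψ t * g t := by
      refine intervalIntegral.integral_congr_ae ?_
      filter_upwards [hg'.ae_hasDerivAt_integral] with t ht htm
      rw [(ht (Set.uIoc_subset_uIcc htm) 0 (by simp)).deriv]
    have hF0 : F 0 = 0 := by simp [hF]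
    rw [hFderiv, hψη, hψT0, hF0] at hparts
    rw [hψη, ← intervalIntegral.integral_of_le hT.le, ← intervalIntegral.integral_of_le hT.le] at hw
    have hmul : ∀ {h : ℝ → ℝ}, IntegrableOn h (Set.Ioc 0 T) →
        IntervalIntegrable (fun t => η t * h t) volume 0 T := fun hh =>
      ((intervalIntegrable_iff_integrableOn_Ioc_of_le hT.le).2 hh).continuousOn_mul
        hη.continuous.continuousOn
    calc ∫ t, η t • (a + F t - f t)
        = ∫ t in Set.Ioc 0 T, η t • (a + F t - f t) := by
          refine (setIntegral_eq_integral_of_forall_compl_eq_zero fun t ht => ?_).symm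
          rw [image_eq_zero_of_notMem_tsupport fun h => ht (Set.Ioo_subset_Ioc_self (hsupp h)),
            zero_smul]
      _ = ∫ t in (0 : ℝ)..T, (η t * a + η t * F t - η t * f t) := by
          rw [intervalIntegral.integral_of_le hT.le]
          simp only [smul_eq_mul, mul_add, mul_sub]
      _ = (∫ t in (0 : ℝ)..T, η t) * a + (∫ t in (0 : ℝ)..T, η t * F t)
            - ∫ t in (0 : ℝ)..T, η t * f t := by
          rw [intervalIntegral.integral_sub ((hmul haint).add (hmul hFint)) (hmul hf),
            intervalIntegral.integral_add (hmul haint) (hmul hFint),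
            intervalIntegral.integral_mul_const]
      _ = 0 := by
          rw [hψint, hψT0]
          linarith
  rw [← restrict_Ioo_eq_restrict_Ioc, ae_restrict_iff' measurableSet_Ioo]
  filter_upwards [hzero] with t ht htm
  rw [← intervalIntegral.integral_of_le htm.1.le]
  exact sub_eq_zero.1 (ht htm)

/-- **Duality, first direction**: if `u` is a solution of the continuity equation in the weak
sense with velocity data `c(t) = u(t)b(t) ∈ L¹(0,T;H)` and initial condition `∂*Ů`, then
`U(t) := Ů + ∫₀ᵗ c(s) ds` satisfies `U(t) ∈ D(∂*)` and `∂* U(t) = u(t)` for a.e. `t ∈ [0,T]`.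
Here `∂ : D → H` is a linear map on a dense subspace `D ⊆ H₀` which is separable with respect to
the graph norm, and the adjoint relation `v ∈ D(∂*)`, `∂* v = g` is expressed by
`⟨v, ∂φ⟩ = ⟨g, φ⟩` for all `φ ∈ D`. -/
theorem stmt_6
    {H₀ : Type*} [NormedAddCommGroup H₀] [InnerProductSpace ℝ H₀] [CompleteSpace H₀]
    {H : Type*} [NormedAddCommGroup H] [InnerProductSpace ℝ H] [CompleteSpace H]
    (D : Submodule ℝ H₀) (hD : Dense (D : Set H₀))
    (par : D →ₗ[ℝ] H)
    (hsep : ∃ S : Set D, S.Countable ∧ ∀ (f : D) (ε : ℝ), 0 < ε →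
      ∃ g ∈ S, Real.sqrt (‖(f : H₀) - (g : H₀)‖ ^ 2 + ‖par f - par g‖ ^ 2) < ε)
    (T : ℝ) (hT : 0 < T)
    (U0 : H) (dU0 : H₀) (hU0 : ∀ φ : D, ⟪U0, par φ⟫ = ⟪dU0, (φ : H₀)⟫)
    (u : ℝ → H₀) (hu : MemLp u 2 (volume.restrict (Set.Ioc (0 : ℝ) T)))
    (c : ℝ → H) (hc : IntegrableOn c (Set.Ioc (0 : ℝ) T))
    (hweak : ∀ (φ : D) (ψ : ℝ → ℝ), ContDiff ℝ 1 ψ →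
      (∃ T' < T, ∀ t, T' ≤ t → ψ t = 0) →
      -∫ t in Set.Ioc (0 : ℝ) T, deriv ψ t * ⟪u t, (φ : H₀)⟫ =
        (∫ t in Set.Ioc (0 : ℝ) T, ψ t * ⟪c t, par φ⟫) + ψ 0 * ⟪dU0, (φ : H₀)⟫) :
    ∀ᵐ t ∂(volume.restrict (Set.Ioc (0 : ℝ) T)),
      ∀ φ : D, ⟪U0 + ∫ s in Set.Ioc (0 : ℝ) t, c s, par φ⟫ = ⟪u t, (φ : H₀)⟫ := by
  obtain ⟨S, hS, hdense⟩ := hsep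
  have hcountable : ∀ᵐ t ∂(volume.restrict (Set.Ioc (0 : ℝ) T)),
      ∀ φ ∈ S, ⟪U0 + ∫ s in Set.Ioc (0 : ℝ) t, c s, par φ⟫ = ⟪u t, (φ : H₀)⟫ := by
    rw [ae_ball_iff hS]
    intro φ _
    have hu' : IntegrableOn u (Set.Ioc (0 : ℝ) T) := hu.integrable one_le_two
    filter_upwards [ae_eq_add_integral_of_weak_deriv hT (hu'.inner_const (φ : H₀))
      (hc.inner_const (par φ)) (hweak φ), ae_restrict_mem measurableSet_Ioc] with t ht htm
    have hct : IntegrableOn c (Set.Ioc 0 t) := hc.mono_set (Set.Ioc_subset_Ioc_right htm.2)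
    rw [← ht, inner_add_left, hU0, real_inner_comm (par φ), ← integral_inner hct]
    simp only [real_inner_comm]
  filter_upwards [hcountable] with t ht φ
  set U : H := U0 + ∫ s in Set.Ioc (0 : ℝ) t, c s
  refine eq_of_forall_dist_le fun ε hε => ?_
  have hK : 0 < ‖U‖ + ‖u t‖ + 1 := by positivity
  obtain ⟨g, hgS, hg⟩ := hdense φ (ε / (‖U‖ + ‖u t‖ + 1)) (by positivity)
  have h₁ : ‖(φ : H₀) - g‖ ≤ ε / (‖U‖ + ‖u t‖ + 1) :=
    (Real.le_sqrt_of_sq_le (le_add_of_nonneg_right (sq_nonneg _))).trans hg.le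
  have h₂ : ‖par φ - par g‖ ≤ ε / (‖U‖ + ‖u t‖ + 1) :=
    (Real.le_sqrt_of_sq_le (le_add_of_nonneg_left (sq_nonneg _))).trans hg.le
  have hsplit : ⟪U, par φ⟫ - ⟪u t, (φ : H₀)⟫ =
      ⟪U, par φ - par g⟫ - ⟪u t, (φ : H₀) - g⟫ := by
    rw [inner_sub_right, inner_sub_right, ht g hgS]
    ring
  rw [Real.dist_eq, hsplit]
  calc |⟪U, par φ - par g⟫ - ⟪u t, (φ : H₀) - g⟫|
      ≤ |⟪U, par φ - par g⟫| + |⟪u t, (φ : H₀) - g⟫| := abs_sub _ _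
    _ ≤ ‖U‖ * ‖par φ - par g‖ + ‖u t‖ * ‖(φ : H₀) - g‖ :=
        add_le_add (abs_real_inner_le_norm _ _) (abs_real_inner_le_norm _ _)
    _ ≤ ‖U‖ * (ε / (‖U‖ + ‖u t‖ + 1)) + ‖u t‖ * (ε / (‖U‖ + ‖u t‖ + 1)) := by gcongr
    _ = (‖U‖ + ‖u t‖) / (‖U‖ + ‖u t‖ + 1) * ε := by ring
    _ ≤ 1 * ε := by
        gcongr
        rw [div_le_one hK]
        linarith
    _ = ε := one_mul ε
end

section
/- Duality, second direction (Proposition 'duality'(ii), abstract form): let H₀ and H be real Hilbert spaces, D a dense linear subspace of H₀, ∂ : D → H a linear map. Let T > 0, Ů ∈ D(∂*), c ∈ L¹(0,T;H), and set U(t) := Ů + ∫₀^t c(s) ds (Bochner integral). Assume that for almost every t ∈ [0,T] one has U(t) ∈ D(∂*) and that u := ∂* U (defined almost everywhere) belongs to L²(0,T;H₀). Then for every φ ∈ D and every continuously differentiable ψ : ℝ → ℝ vanishing on [T',∞) for some T' < T: −∫₀^T ψ'(t)⟨u(t), φ⟩_{H₀} dt = ∫₀^T ψ(t)⟨c(t),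 ∂φ⟩_H dt + ψ(0)⟨∂*Ů, φ⟩_{H₀}. -/
open RealInnerProductSpace MeasureTheory

set_option synthInstance.maxHeartbeats 1000000
set_option maxHeartbeats 1000000

/-- Integration by parts of a `C¹` function vanishing at `b` against an affine primitive of an
interval integrable function. -/
theorem ContDiff.neg_integral_deriv_mul_const_add_primitive {ψ g : ℝ → ℝ} {a b : ℝ}
    (hψ : ContDiff ℝ 1 ψ) (hψb : ψ b = 0) (hg : IntervalIntegrable g volume a b) (k : ℝ) :
    -∫ t in a..b, deriv ψ t * (k + ∫ s in a..t, g s) = (∫ t in a..b, ψ t * g t) + ψ a * k := by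
  have hG : AbsolutelyContinuousOnInterval (fun t ↦ k + ∫ s in a..t, g s) a b :=
    (contDiff_const (c := k)).contDiffOn.absolutelyContinuousOnInterval.fun_add
      (hg.absolutelyContinuousOnInterval_intervalIntegral Set.left_mem_uIcc)
  have hparts := hψ.contDiffOn.absolutelyContinuousOnInterval.integral_mul_deriv_eq_deriv_mul hG
  have hderiv : ∫ t in a..b, ψ t * deriv (fun t ↦ k + ∫ s in a..t, g s) t =
      ∫ t in a..b, ψ t * g t := by
    apply intervalIntegral.integral_congr_ae
    filter_upwards [hg.ae_hasDerivAt_integral] with t ht htab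
    rw [((ht (Set.uIoc_subset_uIcc htab) a Set.left_mem_uIcc).const_add k).deriv]
  rw [hderiv, hψb, intervalIntegral.integral_same] at hparts
  linarith

/-- **Duality, second direction**: let `U(t) := Ů + ∫₀ᵗ c(s) ds` with `Ů ∈ D(∂*)` and
`c ∈ L¹(0,T;H)`. If `U(t) ∈ D(∂*)` for a.e. `t` with `u := ∂* U ∈ L²(0,T;H₀)`, then `u` solves
the continuity equation in the weak sense: for every `φ ∈ D` and every `C¹` function
`ψ : ℝ → ℝ` vanishing on `[T',∞)` for some `T' < T`,
`−∫₀ᵀ ψ'(t)⟨u(t),φ⟩ dt = ∫₀ᵀ ψ(t)⟨c(t),∂φ⟩ dt + ψ(0)⟨∂*Ů,φ⟩`. -/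
theorem stmt_7
    {H₀ : Type*} [NormedAddCommGroup H₀] [InnerProductSpace ℝ H₀] [CompleteSpace H₀]
    {H : Type*} [NormedAddCommGroup H] [InnerProductSpace ℝ H] [CompleteSpace H]
    (D : Submodule ℝ H₀) (hD : Dense (D : Set H₀))
    (par : D →ₗ[ℝ] H)
    (T : ℝ) (hT : 0 < T)
    (U0 : H) (dU0 : H₀) (hU0 : ∀ φ : D, ⟪U0, par φ⟫ = ⟪dU0, (φ : H₀)⟫)
    (c : ℝ → H) (hc : IntegrableOn c (Set.Ioc (0 : ℝ) T))
    (u : ℝ → H₀)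
    (hadj : ∀ᵐ t ∂(volume.restrict (Set.Ioc (0 : ℝ) T)),
      ∀ φ : D, ⟪U0 + ∫ s in Set.Ioc (0 : ℝ) t, c s, par φ⟫ = ⟪u t, (φ : H₀)⟫)
    (hu : MemLp u 2 (volume.restrict (Set.Ioc (0 : ℝ) T))) :
    ∀ (φ : D) (ψ : ℝ → ℝ), ContDiff ℝ 1 ψ →
      (∃ T' < T, ∀ t, T' ≤ t → ψ t = 0) →
      -∫ t in Set.Ioc (0 : ℝ) T, deriv ψ t * ⟪u t, (φ : H₀)⟫ =
        (∫ t in Set.Ioc (0 : ℝ) T, ψ t * ⟪c t, par φ⟫) + ψ 0 * ⟪dU0, (φ : H₀)⟫ := by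
  rintro φ ψ hψ ⟨T', hT', hψT⟩
  have hg : IntervalIntegrable (fun t ↦ ⟪c t, par φ⟫) volume 0 T :=
    (intervalIntegrable_iff_integrableOn_Ioc_of_le hT.le).2 (hc.inner_const (par φ))
  have hparts := hψ.neg_integral_deriv_mul_const_add_primitive (hψT T hT'.le) hg ⟪U0, par φ⟫
  rw [intervalIntegral.integral_of_le hT.le, intervalIntegral.integral_of_le hT.le, hU0] at hparts
  rw [← hparts, ← hU0]
  congr 1
  apply integral_congr_ae
  filter_upwards [hadj, ae_restrict_mem measurableSet_Ioc] with t hadj_t ht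
  have hct : IntegrableOn c (Set.Ioc 0 t) := hc.mono_set (Set.Ioc_subset_Ioc_right ht.2)
  have hinner : ⟪∫ s in Set.Ioc 0 t, c s, par φ⟫ = ∫ s in Set.Ioc 0 t, ⟪c s, par φ⟫ := by
    simp_rw [real_inner_comm (par φ)]
    exact (integral_inner hct (par φ)).symm
  rw [← hadj_t φ, inner_add_left, hinner, intervalIntegral.integral_of_le ht.1.le]
end
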